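/- Assume d ≥ 3, Ω is irreducible, and the torsion-free group Γ divides Ω. If F is a flat of Ω and σ ⊆ ∂Ω is a closed segment with distinct endpoints such that σ ∩ ∂F ≠ ∅, then σ ⊆ ∂F. -/

import Mathlib

open Set Filter Metric

noncomputable section

/-- `ℝ^d`. -/
abbrev Euc (d : ℕ) := EuclideanSpace ℝ (Fin d)

/-- A flat of `Ω` with prescribed vertices `v`. -/
def IsFlatWith {d : ℕ} (Ω : Set (Euc d)) (v : Fin d → Euc d) : Prop :=
  AffineIndependent ℝ v ∧
  (∀ j, v j ∈ closure Ω \ Ω) ∧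
  intrinsicInterior ℝ (convexHull ℝ (Set.range v)) ⊆ Ω ∧
  convexHull ℝ (Set.range v) \ intrinsicInterior ℝ (convexHull ℝ (Set.range v)) ⊆ closure Ω \ Ω

/-- A (codimension-one, properly embedded) flat of `Ω`. -/
def IsFlat {d : ℕ} (Ω : Set (Euc d)) (F : Set (Euc d)) : Prop :=
  ∃ v : Fin d → Euc d, IsFlatWith Ω v ∧ F = intrinsicInterior ℝ (convexHull ℝ (Set.range v))

/-- The cone over a subset of `ℝ^d`, inside `ℝ^d × ℝ ≅ ℝ^{d+1}`. -/
def coneOver {d : ℕ} (S : Set (Euc d)) : Set (Euc d × ℝ) :=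
  {p | ∃ t : ℝ, 0 < t ∧ ∃ x ∈ S, p = t • (x, (1 : ℝ))}

/-- Irreducibility of a properly convex domain: its cone admits no direct-sum
decomposition into convex cones. -/
def IsIrreducibleDomain {d : ℕ} (Ω : Set (Euc d)) : Prop :=
  ¬ ∃ (V₁ V₂ : Submodule ℝ (Euc d × ℝ)) (C₁ C₂ : Set (Euc d × ℝ)),
      V₁ ≠ ⊥ ∧ V₂ ≠ ⊥ ∧ V₁ ≠ ⊤ ∧ V₂ ≠ ⊤ ∧ IsCompl V₁ V₂ ∧
      C₁ ⊆ (V₁ : Set (Euc d × ℝ)) ∧ C₂ ⊆ (V₂ : Set (Euc d × ℝ)) ∧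
      Convex ℝ C₁ ∧ Convex ℝ C₂ ∧
      (∀ t : ℝ, 0 < t → ∀ c ∈ C₁, t • c ∈ C₁) ∧
      (∀ t : ℝ, 0 < t → ∀ c ∈ C₂, t • c ∈ C₂) ∧
      coneOver Ω = {p | ∃ c₁ ∈ C₁, ∃ c₂ ∈ C₂, p = c₁ + c₂}

/-- The homeomorphism of `Ω` induced by a linear automorphism of `ℝ^{d+1}`
preserving the cone over `Ω`. -/
def projAct {d : ℕ} (g : (Euc d × ℝ) ≃ₗ[ℝ] (Euc d × ℝ)) (x : Euc d) : Euc d :=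
  ((g (x, 1)).2)⁻¹ • (g (x, 1)).1

/-- `Γ` divides `Ω`: every element preserves the cone over `Ω`; the induced action on `Ω`
is free and properly discontinuous, and admits a compact set whose translates cover `Ω`. -/
def Divides {d : ℕ} (Ω : Set (Euc d))
    (Γ : Subgroup ((Euc d × ℝ) ≃ₗ[ℝ] (Euc d × ℝ))) : Prop :=
  (∀ γ ∈ Γ, (γ : (Euc d × ℝ) ≃ₗ[ℝ] (Euc d × ℝ)) '' coneOver Ω = coneOver Ω) ∧
  (∀ γ ∈ Γ, γ ≠ 1 → ∀ x ∈ Ω, projAct γ x ≠ x) ∧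
  (∀ K : Set (Euc d), K ⊆ Ω → IsCompact K →
    {γ : (Euc d × ℝ) ≃ₗ[ℝ] (Euc d × ℝ) | γ ∈ Γ ∧ (projAct γ '' K ∩ K).Nonempty}.Finite) ∧
  (∃ K : Set (Euc d), K ⊆ Ω ∧ IsCompact K ∧ (⋃ γ ∈ Γ, projAct γ '' K) = Ω)

/-- `Γ` is torsion-free. -/
def TorsionFreeSub {d : ℕ} (Γ : Subgroup ((Euc d × ℝ) ≃ₗ[ℝ] (Euc d × ℝ))) : Prop :=
  ∀ γ ∈ Γ, ∀ n : ℕ, n ≠ 0 → γ ^ n = 1 → γ = 1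

/-- Convergence of a sequence of flats: Hausdorff convergence of their closures. -/
def FlatsConverge {d : ℕ} (Fs : ℕ → Set (Euc d)) (F : Set (Euc d)) : Prop :=
  Tendsto (fun i => hausdorffDist (closure (Fs i)) (closure F)) atTop (nhds 0)

/-- A flat is isolated if no sequence of flats, all distinct from it, converges to it. -/
def IsIsolatedFlat {d : ℕ} (Ω F : Set (Euc d)) : Prop :=
  ¬ ∃ Fs : ℕ → Set (Euc d), (∀ i, IsFlat Ω (Fs i)) ∧ (∀ i, Fs i ≠ F) ∧ FlatsConverge Fs F

/-- The union of all flats of `Ω`. -/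
def flatsUnion {d : ℕ} (Ω : Set (Euc d)) : Set (Euc d) := ⋃₀ {F | IsFlat Ω F}

/-- A boundary flat: a flat contained in the closure of a connected component of the
complement of the union of all flats. -/
def IsBoundaryFlat {d : ℕ} (Ω F : Set (Euc d)) : Prop :=
  IsFlat Ω F ∧ ∃ x ∈ Ω \ flatsUnion Ω,
    F ⊆ closure (connectedComponentIn (Ω \ flatsUnion Ω) x)

/-- A nonempty open convex cone. -/
structure IsOpenConvexCone {V : Type*} [NormedAddCommGroup V] [NormedSpace ℝ V] (C : Set V) :
    Prop where
  isOpen : IsOpen C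
  convex : Convex ℝ C
  smul_mem : ∀ t : ℝ, 0 < t → ∀ x ∈ C, t • x ∈ C
  nonempty : C.Nonempty

/-- A cone is decomposable if it is a direct sum of convex cones in complementary nonzero
proper subspaces. -/
def IsDecomposableCone {V : Type*} [AddCommGroup V] [Module ℝ V] (C : Set V) : Prop :=
  ∃ (V₁ V₂ : Submodule ℝ V) (C₁ C₂ : Set V),
      V₁ ≠ ⊥ ∧ V₂ ≠ ⊥ ∧ V₁ ≠ ⊤ ∧ V₂ ≠ ⊤ ∧ IsCompl V₁ V₂ ∧
      C₁ ⊆ (V₁ : Set V) ∧ C₂ ⊆ (V₂ : Set V) ∧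
      Convex ℝ C₁ ∧ Convex ℝ C₂ ∧
      (∀ t : ℝ, 0 < t → ∀ c ∈ C₁, t • c ∈ C₁) ∧
      (∀ t : ℝ, 0 < t → ∀ c ∈ C₂, t • c ∈ C₂) ∧
      C = {p | ∃ c₁ ∈ C₁, ∃ c₂ ∈ C₂, p = c₁ + c₂}

/-- A cone is quasi-homogeneous if the linear maps preserving it move all its points into a
compact subset. -/
def IsQuasiHomogeneous {V : Type*} [NormedAddCommGroup V] [NormedSpace ℝ V] (C : Set V) : Prop :=
  ∃ K : Set V, IsCompact K ∧ K ⊆ C ∧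
    ∀ x ∈ C, ∃ γ : V →ₗ[ℝ] V, (∀ z, γ z ∈ C ↔ z ∈ C) ∧ γ x ∈ K

section Cone

variable {V W : Type*} [NormedAddCommGroup V] [NormedSpace ℝ V]
  [NormedAddCommGroup W] [NormedSpace ℝ W] {C : Set V} {D : Set W}

theorem nonneg_of_mem_closure {φ : V →L[ℝ] ℝ} (hφ : ∀ y ∈ C, 0 ≤ φ y) {x : V} (hx : x ∈ closure C) :
    0 ≤ φ x :=
  closure_minimal (s := C) (t := {y | 0 ≤ φ y}) hφ
    (isClosed_le continuous_const φ.continuous) hx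

namespace IsOpenConvexCone

theorem closure_smul_mem (hC : IsOpenConvexCone C) {t : ℝ} (ht : 0 < t) {x : V}
    (hx : x ∈ closure C) : t • x ∈ closure C :=
  map_mem_closure (continuous_const_smul t) hx fun y hy => hC.smul_mem t ht y hy

theorem add_mem_of_closure (hC : IsOpenConvexCone C) {x y : V} (hx : x ∈ C)
    (hy : y ∈ closure C) : x + y ∈ C := by
  have h := hC.convex.combo_interior_closure_mem_interior (hC.isOpen.interior_eq.symm ▸ hx) hy
    (a := 1 / 2) (b := 1 / 2) (by norm_num) (by norm_num) (by norm_num)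
  rw [hC.isOpen.interior_eq] at h
  have h2 := hC.smul_mem 2 (by norm_num) _ h
  rwa [smul_add, smul_smul, smul_smul, show (2 : ℝ) * (1 / 2) = 1 by norm_num, one_smul,
    one_smul] at h2

theorem zero_mem_closure (hC : IsOpenConvexCone C) : (0 : V) ∈ closure C := by
  obtain ⟨x, hx⟩ := hC.nonempty
  have hc : ContinuousWithinAt (fun t : ℝ => t • x) (Ioi 0) 0 :=
    (by fun_prop : Continuous fun t : ℝ => t • x).continuousWithinAt
  have h0 : (0 : ℝ) ∈ closure (Ioi (0 : ℝ)) := by simp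
  simpa using hc.mem_closure h0 fun t ht => hC.smul_mem t ht x hx

theorem closure_smul_mem_of_nonneg (hC : IsOpenConvexCone C) {t : ℝ} (ht : 0 ≤ t) {x : V}
    (hx : x ∈ closure C) : t • x ∈ closure C := by
  rcases ht.eq_or_lt with rfl | ht
  · simpa using hC.zero_mem_closure
  · exact hC.closure_smul_mem ht hx

theorem closure_add_mem (hC : IsOpenConvexCone C) {x y : V} (hx : x ∈ closure C)
    (hy : y ∈ closure C) : x + y ∈ closure C := by
  have h := hC.convex.closure hx hy (a := 1 / 2) (b := 1 / 2) (by norm_num) (by norm_num)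
    (by norm_num)
  have h2 := hC.closure_smul_mem (t := 2) (by norm_num) h
  rwa [smul_add, smul_smul, smul_smul, show (2 : ℝ) * (1 / 2) = 1 by norm_num, one_smul,
    one_smul] at h2

theorem closure_sum_smul_mem (hC : IsOpenConvexCone C) {ι : Type*} (s : Finset ι) {c : ι → ℝ}
    {u : ι → V} (hc : ∀ i ∈ s, 0 ≤ c i) (hu : ∀ i ∈ s, u i ∈ closure C) :
    ∑ i ∈ s, c i • u i ∈ closure C :=
  Finset.sum_induction _ (· ∈ closure C) (fun _ _ => hC.closure_add_mem) hC.zero_mem_closure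
    fun i hi => hC.closure_smul_mem_of_nonneg (hc i hi) (hu i hi)

theorem eventually_add_smul_mem (hC : IsOpenConvexCone C) {y : V} (hy : y ∈ C) (z : V) :
    ∀ᶠ δ : ℝ in nhds 0, y + δ • z ∈ C := by
  have hc : ContinuousAt (fun δ : ℝ => y + δ • z) 0 := by fun_prop
  exact hc.eventually (hC.isOpen.mem_nhds (by simpa using hy))

theorem exists_pos_add_smul_mem (hC : IsOpenConvexCone C) {y : V} (hy : y ∈ C) (z : V) :
    ∃ δ : ℝ, 0 < δ ∧ y + δ • z ∈ C := by
  have h := (hC.eventually_add_smul_mem hy z).filter_mono (nhdsWithin_le_nhds (s := Ioi 0))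
  obtain ⟨δ, h1, h2⟩ := (h.and self_mem_nhdsWithin).exists
  exact ⟨δ, h2, h1⟩

/-- A point outside an open convex cone is separated from it by a linear functional. -/
theorem exists_supporting (hC : IsOpenConvexCone C) {x : V} (hx : x ∉ C) :
    ∃ φ : V →L[ℝ] ℝ, (∀ y ∈ C, 0 < φ y) ∧ φ x ≤ 0 := by
  obtain ⟨f, hf⟩ := geometric_hahn_banach_open_point hC.convex hC.isOpen hx
  have hfx : 0 ≤ f x := by
    have : (0 : V) ∈ {y | f y ≤ f x} :=
      closure_minimal (fun y hy => (hf y hy).le) (isClosed_le f.continuous continuous_const)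
        hC.zero_mem_closure
    simpa using this
  have hle : ∀ y ∈ C, f y ≤ 0 := by
    intro y hy
    by_contra! h
    have := hf _ (hC.smul_mem ((f x + 1) / f y) (by positivity) y hy)
    rw [map_smul, smul_eq_mul, div_mul_cancel₀ _ h.ne'] at this
    linarith
  refine ⟨-f, fun y hy => ?_, by simpa using hfx⟩
  by_contra! h
  have h0 : f y = 0 := le_antisymm (hle y hy) (by simpa using h)
  obtain ⟨z, hz⟩ : ∃ z, 0 < f z := by
    by_contra! hcon
    have hz : f = 0 := by
      ext z
      have h1 := hcon z
      have h2 := hcon (-z)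
      simp only [map_neg] at h2
      rw [zero_apply]
      linarith
    have := hf y hy
    simp [hz] at this
  obtain ⟨δ, hδ, hm⟩ := hC.exists_pos_add_smul_mem hy z
  have := hle _ hm
  rw [map_add, map_smul, h0, smul_eq_mul] at this
  nlinarith

theorem interior_closure_eq (hC : IsOpenConvexCone C) : interior (closure C) = C := by
  rw [hC.convex.interior_closure_eq_interior_of_nonempty_interior, hC.isOpen.interior_eq]
  rw [hC.isOpen.interior_eq]
  exact hC.nonempty

end IsOpenConvexCone

/-- A properly convex cone which is a limit of linear images of a quasi-homogeneous properly
convex cone `C` is linearly equivalent to `C`. -/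
theorem IsQuasiHomogeneous.exists_equiv_limit [FiniteDimensional ℝ V] [FiniteDimensional ℝ W]
    (hdim : Module.finrank ℝ W = Module.finrank ℝ V) (hC : IsOpenConvexCone C)
    (hD : IsOpenConvexCone D) {ψ : V →L[ℝ] ℝ} (hψ : ∀ x ∈ C, ‖x‖ ≤ ψ x)
    (hqh : IsQuasiHomogeneous C) (h : ℕ → W →ₗ[ℝ] V)
    (hin : ∀ z ∈ D, ∀ᶠ n in atTop, h n z ∈ C)
    (hout : ∀ z, (∃ᶠ n in atTop, h n z ∈ C) → z ∈ closure D)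
    (hpt : ∀ z, z ∈ closure D → -z ∈ closure D → z = 0) :
    ∃ g : W ≃ₗ[ℝ] V, ∀ z, g z ∈ C ↔ z ∈ D := by
  obtain ⟨K, hK, hKC, hcov⟩ := hqh
  obtain ⟨y, hy⟩ := hD.nonempty
  have hex : ∀ n, ∃ γ : V →ₗ[ℝ] V, (∀ z, γ z ∈ C ↔ z ∈ C) ∧ (h n y ∈ C → γ (h n y) ∈ K) := by
    intro n
    by_cases hn : h n y ∈ C
    · obtain ⟨γ, h1, h2⟩ := hcov _ hn
      exact ⟨γ, h1, fun _ => h2⟩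
    · exact ⟨LinearMap.id, fun z => Iff.rfl, fun h => absurd h hn⟩
  choose γ hγ hγK using hex
  set g : ℕ → W →ₗ[ℝ] V := fun n => γ n ∘ₗ h n with hg
  have hgC : ∀ n z, g n z ∈ C ↔ h n z ∈ C := fun n z => hγ n _
  let U : Ultrafilter ℕ := hyperfilter ℕ
  have hU : (U : Filter ℕ) ≤ atTop := Nat.hyperfilter_le_atTop
  have hlimD : ∀ z ∈ D, ∃ v, Tendsto (fun n => g n z) U (nhds v) := by
    intro z hz
    obtain ⟨δ, hδ, hyz⟩ := hD.exists_pos_add_smul_mem hy (-z)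
    obtain ⟨M, hM⟩ := (hK.image ψ.continuous).isBounded.bddAbove
    have hev : ∀ᶠ n in U, g n z ∈ closedBall (0 : V) (M / δ) := by
      filter_upwards [hU (hin z hz), hU (hin y hy), hU (hin _ hyz)] with n h1 h2 h3
      have h4 : ψ (g n y) ≤ M := hM ⟨_, hγK n h2, rfl⟩
      have h5 := hψ _ ((hgC n z).2 h1)
      have h6 := (norm_nonneg _).trans (hψ _ ((hgC n _).2 h3))
      rw [map_add, map_smul, map_neg, map_add, map_smul, map_neg, smul_eq_mul] at h6
      rw [mem_closedBall_zero_iff, le_div_iff₀ hδ]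
      nlinarith
    obtain ⟨v, -, hv⟩ := (isCompact_closedBall (0 : V) (M / δ)).ultrafilter_le_nhds
      (U.map fun n => g n z) (le_principal_iff.2 hev)
    exact ⟨v, hv⟩
  have hlim : ∀ z, ∃ v, Tendsto (fun n => g n z) U (nhds v) := by
    intro z
    obtain ⟨δ, hδ, hyz⟩ := hD.exists_pos_add_smul_mem hy z
    obtain ⟨v₁, h₁⟩ := hlimD _ hyz
    obtain ⟨v₂, h₂⟩ := hlimD _ hy
    refine ⟨δ⁻¹ • (v₁ - v₂), ((h₁.sub h₂).const_smul δ⁻¹).congr fun n => ?_⟩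
    rw [map_add, map_smul, add_sub_cancel_left, smul_smul, inv_mul_cancel₀ hδ.ne', one_smul]
  choose G hG using hlim
  let L : W →ₗ[ℝ] V :=
    { toFun := G
      map_add' := fun a b => tendsto_nhds_unique (hG (a + b))
        (((hG a).add (hG b)).congr fun n => (map_add (g n) a b).symm)
      map_smul' := fun t a => tendsto_nhds_unique (hG (t • a))
        (((hG a).const_smul t).congr fun n => (map_smul (g n) t a).symm) }
  have hLD : ∀ z ∈ D, L z ∈ closure C := fun z hz =>
    mem_closure_of_tendsto (hG z) ((hin z hz).filter_mono hU |>.mono fun n hn => (hgC n z).2 hn)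
  have hLy : L y ∈ C :=
    hKC (hK.isClosed.mem_of_tendsto (hG y) ((hin y hy).filter_mono hU |>.mono fun n hn => hγK n hn))
  have hLC : ∀ z, L z ∈ C → z ∈ closure D := by
    intro z hz
    apply hout
    have h1 : ∀ᶠ n in (U : Filter ℕ), h n z ∈ C :=
      ((hG z).eventually (hC.isOpen.mem_nhds hz)).mono fun n hn => (hgC n z).1 hn
    exact h1.frequently.filter_mono hU
  have hinj : Function.Injective L := by
    rw [← LinearMap.ker_eq_bot, LinearMap.ker_eq_bot']
    have key : ∀ z, L z = 0 → z ∈ closure D := by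
      intro z hz
      have hr : ∀ r : ℝ, 0 < r → r • y + z ∈ closure D := by
        intro r hr
        apply hLC
        rw [map_add, hz, add_zero, map_smul]
        exact hC.smul_mem r hr _ hLy
      have hc : ContinuousWithinAt (fun t : ℝ => t • y + z) (Ioi 0) 0 :=
        (by fun_prop : Continuous fun t : ℝ => t • y + z).continuousWithinAt
      have h0 : (0 : ℝ) ∈ closure (Ioi (0 : ℝ)) := by simp
      simpa using hc.mem_closure h0 hr
    exact fun z hz => hpt z (key z hz) (key (-z) (by rw [map_neg, hz, neg_zero]))
  refine ⟨L.linearEquivOfInjective hinj hdim, fun z => ?_⟩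
  rw [LinearMap.linearEquivOfInjective_apply]
  constructor
  · intro hz
    rw [← hD.interior_closure_eq]
    exact mem_interior.2 ⟨L ⁻¹' C, hLC, hC.isOpen.preimage L.continuous_of_finiteDimensional, hz⟩
  · intro hz
    obtain ⟨δ, hδ, hm⟩ := hD.exists_pos_add_smul_mem hz (-y)
    have := hC.add_mem_of_closure (hC.smul_mem δ hδ _ hLy) (hLD _ hm)
    rwa [map_add, map_smul, map_neg, smul_neg, add_comm (L z), add_neg_cancel_left] at this

open scoped Pointwise in
/-- If a subspace `A` is spanned by a subset of the closure of an indecomposable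
quasi-homogeneous cone `C`, then the image of `C` in `V ⧸ A` is not properly convex: some vector
outside `A` is annihilated by all functionals nonnegative on `C` and vanishing on `A`. -/
theorem IsQuasiHomogeneous.exists_notMem_span [FiniteDimensional ℝ V]
    (hC : IsOpenConvexCone C) {ψ : V →L[ℝ] ℝ} (hψ : ∀ x ∈ C, ‖x‖ ≤ ψ x)
    (hqh : IsQuasiHomogeneous C) (hirr : ¬ IsDecomposableCone C) {T : Set V}
    (hTC : T ⊆ closure C) (hbot : Submodule.span ℝ T ≠ ⊥) (htop : Submodule.span ℝ T ≠ ⊤) :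
    ∃ w ∉ Submodule.span ℝ T, ∀ φ : V →L[ℝ] ℝ, (∀ x ∈ C, 0 ≤ φ x) → (∀ x ∈ T, φ x = 0) →
      φ w = 0 := by
  set A := Submodule.span ℝ T with hA
  obtain ⟨B, hAB⟩ := A.exists_isCompl
  have hBbot : B ≠ ⊥ := by
    rintro rfl
    exact htop (by simpa using hAB.sup_eq_top)
  let S : Set A := (↑) ⁻¹' closure C
  have hSconv : Convex ℝ S := hC.convex.closure.linear_preimage A.subtype
  have hSclosed : IsClosed S := isClosed_closure.preimage continuous_subtype_val
  have hSint : (interior S).Nonempty := by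
    rw [hSconv.interior_nonempty_iff_affineSpan_eq_top]
    have h0 : (0 : A) ∈ S := hC.zero_mem_closure
    rw [← insert_eq_of_mem h0]
    apply SetLike.coe_injective
    rw [affineSpan_insert_zero]
    have h1 : (↑) ⁻¹' T ⊆ S := fun x hx => hTC hx
    have h2 := Submodule.span_mono (R := ℝ) h1
    rw [Submodule.span_span_coe_preimage, top_le_iff] at h2
    rw [h2]
    rfl
  have hSsmul : ∀ t : ℝ, 0 < t → ∀ x ∈ interior S, t • x ∈ interior S := by
    intro t ht x hx
    have : t • interior S ⊆ S := by
      rintro _ ⟨z, hz, rfl⟩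
      exact hC.closure_smul_mem ht (interior_subset hz : z ∈ S)
    exact interior_maximal this (isOpen_interior.smul₀ ht.ne') ⟨x, hx, rfl⟩
  let Q : Set B := {b | ∃ a : A, (a : V) + b ∈ C}
  have hQ : IsOpenConvexCone Q := by
    refine ⟨?_, ?_, ?_, ?_⟩
    · have : Q = ⋃ a : A, {b : B | (a : V) + b ∈ C} := by ext; simp [Q]
      rw [this]
      exact isOpen_iUnion fun a => hC.isOpen.preimage (by fun_prop)
    · rintro b ⟨a, h⟩ b' ⟨a', h'⟩ s t hs ht hst
      refine ⟨s • a + t • a', ?_⟩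
      have := hC.convex h h' hs ht hst
      convert this using 1
      push_cast
      module
    · rintro t ht b ⟨a, h⟩
      refine ⟨t • a, ?_⟩
      have := hC.smul_mem t ht _ h
      rwa [smul_add] at this
    · obtain ⟨x, hx⟩ := hC.nonempty
      obtain ⟨a, ha, b, hb, rfl⟩ := Submodule.mem_sup.1
        (hAB.sup_eq_top ▸ Submodule.mem_top : x ∈ A ⊔ B)
      exact ⟨⟨b, hb⟩, ⟨a, ha⟩, hx⟩
  let D : Set (A × B) := interior S ×ˢ Q
  have hD : IsOpenConvexCone D :=
    ⟨isOpen_interior.prod hQ.isOpen, hSconv.interior.prod hQ.convex,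
      fun t ht x hx => ⟨hSsmul t ht _ hx.1, hQ.smul_mem t ht _ hx.2⟩, hSint.prod hQ.nonempty⟩
  have hclD : closure D = S ×ˢ closure Q := by
    rw [closure_prod_eq, hSconv.closure_interior_eq_closure_of_nonempty_interior hSint,
      hSclosed.closure_eq]
  have hpointed : ∀ x, x ∈ closure C → -x ∈ closure C → x = 0 := by
    have hcl : ∀ x ∈ closure C, ‖x‖ ≤ ψ x := fun x hx =>
      closure_minimal (s := C) (t := {y | ‖y‖ ≤ ψ y}) hψ
        (isClosed_le continuous_norm ψ.continuous) hx
    intro x h1 h2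
    have h3 := hcl x h1
    have h4 := hcl _ h2
    rw [norm_neg, map_neg] at h4
    exact norm_le_zero_iff.1 (by linarith)
  by_cases hpt : ∀ b, b ∈ closure Q → -b ∈ closure Q → b = 0
  · exfalso
    let e := A.prodEquivOfIsCompl B hAB
    let s : ℕ → ℝ := fun n => 1 / ((n : ℝ) + 1)
    have hs0 : ∀ n, 0 < s n := fun n => Nat.one_div_pos_of_nat
    have hs : Tendsto s atTop (nhds 0) := tendsto_one_div_add_atTop_nhds_zero_nat
    let h : ℕ → A × B →ₗ[ℝ] V := fun n => A.subtype.coprod (s n • B.subtype)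
    have happ : ∀ n z, h n z = (z.1 : V) + s n • (z.2 : V) := fun n z => rfl
    have hdim : Module.finrank ℝ (A × B) = Module.finrank ℝ V := e.finrank_eq
    obtain ⟨g, hg⟩ := hqh.exists_equiv_limit hdim hC hD hψ h (by
      rintro ⟨a, b⟩ ⟨ha, a₀, hb⟩
      have hc : Tendsto (fun n => a + s n • (-a₀)) atTop (nhds a) := by
        simpa using (hs.smul_const (-a₀)).const_add a
      filter_upwards [hc.eventually (isOpen_interior.mem_nhds ha)] with n hn
      have h1 : ((a + s n • (-a₀) : A) : V) ∈ closure C := (interior_subset hn : _ ∈ S)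
      have h2 := hC.add_mem_of_closure (hC.smul_mem _ (hs0 n) _ hb) h1
      rw [happ]
      convert h2 using 1
      push_cast
      module) (by
      rintro ⟨a, b⟩ hfr
      rw [hclD]
      have hc : Tendsto (fun n => h n (a, b)) atTop (nhds (a : V)) := by
        simp only [happ]
        simpa using (hs.smul_const (b : V)).const_add (a : V)
      refine ⟨mem_closure_of_frequently_of_tendsto hfr hc, subset_closure ?_⟩
      obtain ⟨n, hn⟩ := hfr.exists
      have h1 : s n • b ∈ Q := ⟨a, hn⟩
      have h2 := hQ.smul_mem (s n)⁻¹ (inv_pos.2 (hs0 n)) _ h1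
      rwa [smul_smul, inv_mul_cancel₀ (hs0 n).ne', one_smul] at h2) (by
      rintro ⟨a, b⟩ h1 h2
      rw [hclD] at h1 h2
      refine Prod.ext (Subtype.ext (hpointed _ h1.1 ?_)) (hpt _ h1.2 h2.2)
      exact (h2.1 : (-a) ∈ S))
    have hcompl : IsCompl ((LinearMap.range (LinearMap.inl ℝ A B)).map g.toLinearMap)
        ((LinearMap.range (LinearMap.inr ℝ A B)).map g.toLinearMap) :=
      (Submodule.orderIsoMapComap g).isCompl LinearMap.isCompl_range_inl_inr
    have hA0 : (LinearMap.range (LinearMap.inl ℝ A B)).map g.toLinearMap ≠ ⊥ := by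
      obtain ⟨a, ha, ha0⟩ := A.exists_mem_ne_zero_of_ne_bot hbot
      refine (Submodule.ne_bot_iff _).2 ⟨g (⟨a, ha⟩, 0), ⟨_, ⟨⟨a, ha⟩, rfl⟩, rfl⟩, ?_⟩
      simpa using ha0
    have hB0 : (LinearMap.range (LinearMap.inr ℝ A B)).map g.toLinearMap ≠ ⊥ := by
      obtain ⟨b, hb, hb0⟩ := B.exists_mem_ne_zero_of_ne_bot hBbot
      refine (Submodule.ne_bot_iff _).2 ⟨g (0, ⟨b, hb⟩), ⟨_, ⟨⟨b, hb⟩, rfl⟩, rfl⟩, ?_⟩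
      simpa using hb0
    refine hirr ⟨_, _, (g.toLinearMap ∘ₗ LinearMap.inl ℝ A B) '' interior S,
      (g.toLinearMap ∘ₗ LinearMap.inr ℝ A B) '' Q, hA0, hB0, ?_, ?_, hcompl, ?_, ?_,
      hSconv.interior.linear_image _, hQ.convex.linear_image _, ?_, ?_, ?_⟩
    · intro htop'
      rw [htop', isCompl_comm] at hcompl
      exact hB0 (eq_bot_of_isCompl_top hcompl)
    · intro htop'
      rw [htop'] at hcompl
      exact hA0 (eq_bot_of_isCompl_top hcompl)
    · rintro _ ⟨a, -, rfl⟩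
      exact ⟨_, ⟨a, rfl⟩, rfl⟩
    · rintro _ ⟨b, -, rfl⟩
      exact ⟨_, ⟨b, rfl⟩, rfl⟩
    · rintro t ht _ ⟨a, ha, rfl⟩
      exact ⟨t • a, hSsmul t ht a ha, map_smul _ _ _⟩
    · rintro t ht _ ⟨b, hb, rfl⟩
      exact ⟨t • b, hQ.smul_mem t ht b hb, map_smul _ _ _⟩
    · ext x
      constructor
      · intro hx
        have h1 : g.symm x ∈ D := (hg _).1 (by simpa using hx)
        refine ⟨_, ⟨_, h1.1, rfl⟩, _, ⟨_, h1.2, rfl⟩, ?_⟩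
        rw [LinearMap.comp_apply, LinearMap.comp_apply, ← map_add]
        simp
      · rintro ⟨_, ⟨a, ha, rfl⟩, _, ⟨b, hb, rfl⟩, rfl⟩
        rw [LinearMap.comp_apply, LinearMap.comp_apply, ← map_add]
        exact (hg _).2 (by simpa using ⟨ha, hb⟩)
  · push Not at hpt
    obtain ⟨b, h1, h2, h3⟩ := hpt
    refine ⟨b, fun hb => h3 ?_, fun φ hφ hφT => ?_⟩
    · exact Subtype.ext (Submodule.disjoint_def.1 hAB.disjoint _ hb b.2)
    · have hφA : ∀ a ∈ A, φ a = 0 := fun a ha =>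
        (Submodule.span_le.2 (fun x hx => hφT x hx) : A ≤ LinearMap.ker φ.toLinearMap) ha
      have hφQ : ∀ x ∈ Q, 0 ≤ (φ.comp B.subtypeL) x := by
        rintro x ⟨a, hx⟩
        have := hφ _ hx
        rwa [map_add, hφA a a.2, zero_add] at this
      have h4 := nonneg_of_mem_closure hφQ h1
      have h5 := nonneg_of_mem_closure hφQ h2
      simp only [map_neg] at h5
      exact le_antisymm (by simpa using h5) h4

/-- Let `u` span the cone over a properly embedded codimension-one simplex of an indecomposable
quasi-homogeneous cone `C`. If `p` lies on the simplex and `q` is a point of the closure of `C`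
with `p + q ∉ C`, then `q` lies in the cone over the simplex. -/
theorem IsQuasiHomogeneous.exists_eq_sum_of_add_notMem [FiniteDimensional ℝ V]
    (hC : IsOpenConvexCone C) {ψ : V →L[ℝ] ℝ} (hψ : ∀ x ∈ C, ‖x‖ ≤ ψ x)
    (hqh : IsQuasiHomogeneous C) (hirr : ¬ IsDecomposableCone C)
    {ι : Type*} [Fintype ι] [DecidableEq ι] [Nontrivial ι]
    (hcard : Module.finrank ℝ V = Fintype.card ι + 1) {u : ι → V}
    (hu : ∀ i, u i ∈ closure C) (hsum : ∑ i, u i ∈ C)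
    (hfacet : ∀ j, ∑ i ∈ Finset.univ.erase j, u i ∉ C)
    {c : ι → ℝ} (hc : ∀ i, 0 ≤ c i) (hc0 : ∃ i, 0 < c i) {q : V} (hq : q ∈ closure C)
    (hpq : ∑ i, c i • u i + q ∉ C) :
    ∃ x : ι → ℝ, (∀ i, 0 ≤ x i) ∧ q = ∑ i, x i • u i := by
  have hφex : ∀ j, ∃ φ : V →L[ℝ] ℝ, (∀ y ∈ C, 0 ≤ φ y) ∧ φ (u j) = 1 ∧
      ∀ i, i ≠ j → φ (u i) = 0 := by
    intro j
    obtain ⟨φ, hpos, hle⟩ := hC.exists_supporting (hfacet j)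
    have hnn : ∀ i, 0 ≤ φ (u i) := fun i =>
      nonneg_of_mem_closure (fun y hy => (hpos y hy).le) (hu i)
    rw [map_sum] at hle
    have h0 : ∀ i, i ≠ j → φ (u i) = 0 := fun i hij =>
      (Finset.sum_eq_zero_iff_of_nonneg fun i _ => hnn i).1
        (le_antisymm hle (Finset.sum_nonneg fun i _ => hnn i)) i (by simp [hij])
    have hj : 0 < φ (u j) := by
      have := hpos _ hsum
      rwa [map_sum, Finset.sum_eq_single j (fun i _ hij => h0 i hij) (by simp)] at this
    refine ⟨(φ (u j))⁻¹ • φ, fun y hy => ?_, ?_, fun i hij => ?_⟩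
    · simpa using mul_nonneg (inv_nonneg.2 hj.le) (hpos y hy).le
    · simp [hj.ne']
    · simp [h0 i hij]
  choose φ hφC hφ1 hφ0 using hφex
  have hφu : ∀ j i, φ j (u i) = if i = j then 1 else 0 := by
    intro j i
    split_ifs with h
    · rw [h, hφ1]
    · exact hφ0 j i h
  have hu0 : ∀ i, u i ≠ 0 := fun i h => by simpa [h] using hφ1 i
  let Φ : V →ₗ[ℝ] ι → ℝ := LinearMap.pi fun j => (φ j).toLinearMap
  have hΦ : ∀ x j, Φ x j = φ j x := fun x j => rfl
  have hsurj : LinearMap.range Φ = ⊤ := by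
    rw [LinearMap.range_eq_top]
    intro y
    refine ⟨∑ i, y i • u i, ?_⟩
    ext j
    simp [hΦ, hφu]
  have hker : Module.finrank ℝ (LinearMap.ker Φ) = 1 := by
    have := Φ.finrank_range_add_finrank_ker
    rw [hsurj, finrank_top, Module.finrank_fintype_fun_eq_card, hcard] at this
    omega
  obtain ⟨⟨u₀, hu₀⟩, hne, hspan⟩ := finrank_eq_one_iff'.1 hker
  have hφu₀ : ∀ j, φ j u₀ = 0 := fun j => congrFun (LinearMap.mem_ker.1 hu₀) j
  have hdec : ∀ x, ∃ t : ℝ, x = ∑ i, φ i x • u i + t • u₀ := by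
    intro x
    have hx : x - ∑ i, φ i x • u i ∈ LinearMap.ker Φ := by
      rw [LinearMap.mem_ker]
      ext j
      simp [hΦ, hφu]
    obtain ⟨t, ht⟩ := hspan ⟨_, hx⟩
    refine ⟨t, ?_⟩
    have := congrArg Subtype.val ht
    simp only [SetLike.mk_smul_mk] at this
    rw [this]
    abel
  have hvert : ∀ i, ∀ χ : V →L[ℝ] ℝ, (∀ y ∈ C, 0 ≤ χ y) → χ (u i) = 0 → χ u₀ = 0 := by
    intro i χ hχ hχi
    obtain ⟨j, hji⟩ := exists_ne i
    obtain ⟨w, hw, hwφ⟩ := hqh.exists_notMem_span hC hψ hirr (T := {u i}) (by simpa using hu i)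
      (by simpa using hu0 i) (by
        intro h
        have : u j ∈ Submodule.span ℝ {u i} := h ▸ Submodule.mem_top
        obtain ⟨a, ha⟩ := Submodule.mem_span_singleton.1 this
        have h1 := hφ1 j
        rw [← ha, map_smul, hφ0 j i hji.symm, smul_zero] at h1
        exact zero_ne_one h1)
    obtain ⟨t, ht⟩ := hdec w
    rw [Finset.sum_eq_single i (fun j _ hj => by
      rw [hwφ (φ j) (hφC j) (by simpa using hφ0 j i hj.symm), zero_smul]) (by simp)] at ht
    have ht0 : t ≠ 0 := by
      rintro rfl
      refine hw (Submodule.mem_span_singleton.2 ⟨φ i w, ?_⟩)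
      rw [zero_smul, add_zero] at ht
      exact ht.symm
    have h1 := hwφ χ hχ (by simpa using hχi)
    rw [ht, map_add, map_smul, map_smul, hχi, smul_zero, zero_add, smul_eq_mul] at h1
    exact (mul_eq_zero.1 h1).resolve_left ht0
  obtain ⟨χ, hχpos, hχle⟩ := hC.exists_supporting hpq
  have hχC : ∀ y ∈ C, 0 ≤ χ y := fun y hy => (hχpos y hy).le
  have hχu : ∀ i, 0 ≤ χ (u i) := fun i => nonneg_of_mem_closure hχC (hu i)
  have hχq : 0 ≤ χ q := nonneg_of_mem_closure hχC hq
  have hterm : ∀ i ∈ Finset.univ, 0 ≤ c i * χ (u i) := fun i _ => mul_nonneg (hc i) (hχu i)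
  have hsum0 : 0 ≤ ∑ i, c i * χ (u i) := Finset.sum_nonneg hterm
  simp only [map_add, map_sum, map_smul, smul_eq_mul] at hχle
  have hχq0 : χ q = 0 := by linarith
  obtain ⟨k, hk⟩ := hc0
  have hχk : χ (u k) = 0 := by
    have := (Finset.sum_eq_zero_iff_of_nonneg hterm).1 (by linarith) k (Finset.mem_univ k)
    exact (mul_eq_zero.1 this).resolve_left hk.ne'
  have hχu₀ : χ u₀ = 0 := hvert k χ hχC hχk
  have hφq : ∀ i, 0 ≤ φ i q := fun i => nonneg_of_mem_closure (hφC i) hq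
  obtain ⟨t, ht⟩ := hdec q
  have hx0 : ∀ i, χ (u i) ≠ 0 → φ i q = 0 := by
    intro i hi
    have h1 := hχq0
    rw [ht] at h1
    simp only [map_add, map_sum, map_smul, smul_eq_mul, hχu₀, mul_zero, add_zero] at h1
    have := (Finset.sum_eq_zero_iff_of_nonneg
      fun i _ => mul_nonneg (hφq i) (hχu i)).1 h1 i (Finset.mem_univ i)
    exact (mul_eq_zero.1 this).resolve_right hi
  rcases eq_or_ne t 0 with rfl | ht0
  · exact ⟨fun i => φ i q, hφq, by simpa using ht⟩
  exfalso
  set T : Set V := insert q {v | ∃ i, χ (u i) = 0 ∧ v = u i} with hT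
  have hTu : ∀ i, χ (u i) = 0 → u i ∈ Submodule.span ℝ T := fun i hi =>
    Submodule.subset_span (Or.inr ⟨i, hi, rfl⟩)
  have hχT : T ⊆ LinearMap.ker χ.toLinearMap := by
    rintro v (rfl | ⟨i, hi, rfl⟩)
    exacts [hχq0, hi]
  obtain ⟨w, hw, hwφ⟩ := hqh.exists_notMem_span hC hψ hirr (T := T)
    (by rintro v (rfl | ⟨i, hi, rfl⟩); exacts [hq, hu i])
    ((Submodule.ne_bot_iff _).2 ⟨u k, hTu k hχk, hu0 k⟩) (by
      intro h
      obtain ⟨y, hy⟩ := hC.nonempty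
      have : y ∈ Submodule.span ℝ T := h ▸ Submodule.mem_top
      exact (hχpos y hy).ne' (Submodule.span_le.2 hχT this))
  have hsumT : ∀ x : ι → ℝ, (∀ i, χ (u i) ≠ 0 → x i = 0) →
      ∑ i, x i • u i ∈ Submodule.span ℝ T := by
    intro x hx
    refine Submodule.sum_mem _ fun i _ => ?_
    by_cases hi : χ (u i) = 0
    · exact Submodule.smul_mem _ _ (hTu i hi)
    · simp [hx i hi]
  have hu₀T : u₀ ∈ Submodule.span ℝ T := by
    have h1 : t • u₀ ∈ Submodule.span ℝ T := by
      rw [← sub_eq_iff_eq_add'.2 ht]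
      exact Submodule.sub_mem _ (Submodule.subset_span (Or.inl rfl)) (hsumT _ hx0)
    exact (Submodule.smul_mem_iff _ ht0).1 h1
  obtain ⟨s, hs⟩ := hdec w
  refine hw (hs ▸ Submodule.add_mem _ (hsumT _ fun j hj => ?_) (Submodule.smul_mem _ _ hu₀T))
  refine hwφ (φ j) (hφC j) ?_
  rintro v (rfl | ⟨i, hi, rfl⟩)
  · exact hx0 j hj
  · exact hφ0 j i (by rintro rfl; exact hj hi)

end Cone

theorem mem_convexHull_range_iff {E ι : Type*} [AddCommGroup E] [Module ℝ E] [Fintype ι]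
    {v : ι → E} {z : E} : z ∈ convexHull ℝ (range v) ↔
      ∃ c : ι → ℝ, (∀ i, 0 ≤ c i) ∧ ∑ i, c i = 1 ∧ ∑ i, c i • v i = z := by
  classical
  constructor
  · have hconv : Convex ℝ {z | ∃ c : ι → ℝ, (∀ i, 0 ≤ c i) ∧ ∑ i, c i = 1 ∧
        ∑ i, c i • v i = z} := by
      rintro _ ⟨c, hc, hc1, rfl⟩ _ ⟨c', hc', hc1', rfl⟩ s t hs ht hst
      refine ⟨fun i => s * c i + t * c' i, fun i => ?_, ?_, ?_⟩
      · exact add_nonneg (mul_nonneg hs (hc i)) (mul_nonneg ht (hc' i))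
      · rw [Finset.sum_add_distrib, ← Finset.mul_sum, ← Finset.mul_sum, hc1, hc1', mul_one,
          mul_one, hst]
      · simp only [add_smul, mul_smul, Finset.sum_add_distrib, Finset.smul_sum]
    refine fun hz => convexHull_min ?_ hconv hz
    rintro _ ⟨i, rfl⟩
    refine ⟨Pi.single i 1, fun j => ?_, by simp, by simp [Pi.single_apply]⟩
    rw [Pi.single_apply]
    split_ifs <;> simp
  · rintro ⟨c, hc, hc1, rfl⟩
    exact (convex_convexHull ℝ _).sum_mem (fun i _ => hc i) hc1
      fun i _ => subset_convexHull ℝ _ (mem_range_self i)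

section IntrinsicInterior

variable {E : Type*} [NormedAddCommGroup E] [NormedSpace ℝ E] {s : Set E} {o z : E}

theorem eventually_lineMap_mem_of_mem_intrinsicInterior (ho : o ∈ intrinsicInterior ℝ s)
    (hz : z ∈ s) : ∀ᶠ t : ℝ in nhds 1, AffineMap.lineMap z o t ∈ s := by
  obtain ⟨y, hy, rfl⟩ := mem_intrinsicInterior.1 ho
  let z' : affineSpan ℝ s := ⟨z, subset_affineSpan ℝ s hz⟩
  let ρ : ℝ → affineSpan ℝ s := fun t =>
    ⟨AffineMap.lineMap z (y : E) t, AffineMap.lineMap_mem t z'.2 y.2⟩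
  have hρ : Continuous ρ := AffineMap.lineMap_continuous.subtype_mk _
  have hρ1 : ρ 1 = y := Subtype.ext (AffineMap.lineMap_apply_one _ _)
  exact hρ.continuousAt.eventually
    (mem_of_superset (isOpen_interior.mem_nhds (hρ1 ▸ hy)) interior_subset)

theorem Convex.lineMap_mem_intrinsicInterior (hs : Convex ℝ s) (ho : o ∈ intrinsicInterior ℝ s)
    (hz : z ∈ s) {t : ℝ} (ht0 : 0 < t) (ht1 : t ≤ 1) :
    AffineMap.lineMap z o t ∈ intrinsicInterior ℝ s := by
  obtain ⟨y, hy, rfl⟩ := mem_intrinsicInterior.1 ho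
  have hz' : z ∈ affineSpan ℝ s := subset_affineSpan ℝ s hz
  let ρ : affineSpan ℝ s → affineSpan ℝ s := fun x =>
    ⟨AffineMap.lineMap z (x : E) t⁻¹, AffineMap.lineMap_mem _ hz' x.2⟩
  have hρ : Continuous ρ := by
    refine Continuous.subtype_mk ?_ _
    simp only [AffineMap.lineMap_apply_module']
    fun_prop
  refine mem_intrinsicInterior.2 ⟨⟨AffineMap.lineMap z (y : E) t,
    AffineMap.lineMap_mem _ hz' y.2⟩, ?_, rfl⟩
  refine mem_interior.2 ⟨ρ ⁻¹' interior ((↑) ⁻¹' s), ?_, isOpen_interior.preimage hρ, ?_⟩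
  · intro x hx
    have hx' : AffineMap.lineMap z (x : E) t⁻¹ ∈ s := (interior_subset hx : ρ x ∈ (↑) ⁻¹' s)
    have := hs.lineMap_mem hz hx' ⟨ht0.le, ht1⟩
    simpa [AffineMap.lineMap_apply_module', smul_smul, ht0.ne'] using this
  · have : ρ ⟨AffineMap.lineMap z (y : E) t, AffineMap.lineMap_mem _ hz' y.2⟩ = y := by
      apply Subtype.ext
      simp [ρ, AffineMap.lineMap_apply_module', smul_smul, ht0.ne']
    rw [mem_preimage, this]
    exact hy

theorem Convex.subset_closure_intrinsicInterior (hs : Convex ℝ s)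
    (ho : (intrinsicInterior ℝ s).Nonempty) : s ⊆ closure (intrinsicInterior ℝ s) := by
  obtain ⟨o, ho⟩ := ho
  intro z hz
  have hc : ContinuousWithinAt (AffineMap.lineMap z o : ℝ → E) (Ioc 0 1) 0 :=
    AffineMap.lineMap_continuous.continuousWithinAt
  have h0 : (0 : ℝ) ∈ closure (Ioc (0 : ℝ) 1) := by
    rw [closure_Ioc zero_ne_one]
    simp
  have := hc.mem_closure h0 fun t ht => hs.lineMap_mem_intrinsicInterior ho hz ht.1 ht.2
  rwa [AffineMap.lineMap_apply_zero] at this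

/-- Points on a facet of a simplex do not lie in its intrinsic interior. -/
theorem AffineIndependent.sum_notMem_intrinsicInterior {ι : Type*} [Fintype ι] {v : ι → E}
    (hv : AffineIndependent ℝ v) {c : ι → ℝ} (hc1 : ∑ i, c i = 1) {j : ι} (hj : c j = 0) :
    ∑ i, c i • v i ∉ intrinsicInterior ℝ (convexHull ℝ (range v)) := by
  classical
  intro h
  have hev := (eventually_lineMap_mem_of_mem_intrinsicInterior h
    (subset_convexHull ℝ _ (mem_range_self j))).filter_mono (nhdsWithin_le_nhds (s := Ioi 1))
  obtain ⟨t, ht, ht1⟩ := (hev.and self_mem_nhdsWithin).exists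
  obtain ⟨x, hx, hx1, hxs⟩ := mem_convexHull_range_iff.1 ht
  rw [AffineMap.lineMap_apply_module] at hxs
  have h0 := (affineIndependent_iff.1 hv) Finset.univ
    (fun i => x i - (if i = j then 1 - t else 0) - t * c i)
    (by simp [Finset.sum_sub_distrib, ← Finset.mul_sum, hx1, hc1])
    (by
      simp only [sub_smul, Finset.sum_sub_distrib, ite_smul, zero_smul, mul_smul,
        Finset.sum_ite_eq', Finset.mem_univ, if_true, ← Finset.smul_sum, hxs]
      abel_nf) j (Finset.mem_univ j)
  have := hx j
  simp only [if_true, hj, mul_zero, sub_zero] at h0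
  have : 1 < t := ht1
  linarith

end IntrinsicInterior

section ConeOver

variable {d : ℕ} {Ω : Set (Euc d)}

theorem mem_coneOver_iff {p : Euc d × ℝ} : p ∈ coneOver Ω ↔ 0 < p.2 ∧ p.2⁻¹ • p.1 ∈ Ω := by
  constructor
  · rintro ⟨t, ht, x, hx, rfl⟩
    simpa [ht, smul_smul, ht.ne'] using hx
  · rintro ⟨h1, h2⟩
    refine ⟨p.2, h1, _, h2, ?_⟩
    ext1 <;> simp [smul_smul, h1.ne']

theorem mk_one_mem_coneOver_iff {x : Euc d} : ((x, 1) : Euc d × ℝ) ∈ coneOver Ω ↔ x ∈ Ω := by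
  simp [mem_coneOver_iff]

theorem mk_one_mem_closure_coneOver {x : Euc d} (hx : x ∈ closure Ω) :
    ((x, 1) : Euc d × ℝ) ∈ closure (coneOver Ω) :=
  map_mem_closure (f := fun x : Euc d => (x, (1 : ℝ))) (by fun_prop) hx
    fun _ hy => mk_one_mem_coneOver_iff.2 hy

theorem smul_mem_coneOver {t : ℝ} (ht : 0 < t) {p : Euc d × ℝ} (hp : p ∈ coneOver Ω) :
    t • p ∈ coneOver Ω := by
  obtain ⟨s, hs, x, hx, rfl⟩ := hp
  exact ⟨t * s, mul_pos ht hs, x, hx, smul_smul _ _ _⟩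

theorem isOpenConvexCone_coneOver (hne : Ω.Nonempty) (hop : IsOpen Ω) (hconv : Convex ℝ Ω) :
    IsOpenConvexCone (coneOver Ω) where
  isOpen := by
    have h1 : IsOpen {p : Euc d × ℝ | 0 < p.2} := isOpen_lt continuous_const continuous_snd
    have h2 : ContinuousOn (fun p : Euc d × ℝ => p.2⁻¹ • p.1) {p | 0 < p.2} :=
      (continuousOn_snd.inv₀ fun p hp => ne_of_gt hp).smul continuousOn_fst
    have h3 := h2.isOpen_inter_preimage h1 hop
    have h4 : coneOver Ω = {p | 0 < p.2} ∩ (fun p : Euc d × ℝ => p.2⁻¹ • p.1) ⁻¹' Ω :=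
      Set.ext fun p => mem_coneOver_iff
    rwa [h4]
  convex := by
    rintro _ ⟨s, hs, x, hx, rfl⟩ _ ⟨t, ht, y, hy, rfl⟩ a b ha hb hab
    have hpos : 0 < a * s + b * t := by
      rcases ha.eq_or_lt with rfl | ha
      · have : b = 1 := by linarith
        simpa [this] using ht
      · positivity
    refine ⟨a * s + b * t, hpos, (a * s / (a * s + b * t)) • x + (b * t / (a * s + b * t)) • y,
      hconv hx hy (by positivity) (by positivity) (by field_simp), ?_⟩
    ext1
    · simp [smul_smul, mul_div_cancel₀ _ hpos.ne']
    · simp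
  smul_mem _ ht _ hp := smul_mem_coneOver ht hp
  nonempty := by
    obtain ⟨x, hx⟩ := hne
    exact ⟨(x, 1), mk_one_mem_coneOver_iff.2 hx⟩

theorem exists_norm_le_of_mem_coneOver (hbd : Bornology.IsBounded Ω) :
    ∃ ψ : (Euc d × ℝ) →L[ℝ] ℝ, ∀ p ∈ coneOver Ω, ‖p‖ ≤ ψ p := by
  obtain ⟨R, hR⟩ := hbd.exists_norm_le
  refine ⟨max R 1 • ContinuousLinearMap.snd ℝ (Euc d) ℝ, ?_⟩
  rintro _ ⟨t, ht, x, hx, rfl⟩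
  have h : ‖((x, 1) : Euc d × ℝ)‖ ≤ max R 1 := by
    rw [Prod.norm_def]
    exact max_le_max (hR x hx) (by simp)
  rw [norm_smul, Real.norm_of_nonneg ht.le]
  simpa [mul_comm] using mul_le_mul_of_nonneg_left h ht.le

theorem Divides.isQuasiHomogeneous_coneOver
    {Γ : Subgroup ((Euc d × ℝ) ≃ₗ[ℝ] (Euc d × ℝ))} (hdiv : Divides Ω Γ) :
    IsQuasiHomogeneous (coneOver Ω) := by
  obtain ⟨hpres, -, -, K, hKΩ, hK, hcov⟩ := hdiv
  refine ⟨(fun x => (x, (1 : ℝ))) '' K, hK.image (by fun_prop), ?_, ?_⟩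
  · rintro _ ⟨x, hx, rfl⟩
    exact mk_one_mem_coneOver_iff.2 (hKΩ hx)
  · rintro _ ⟨t, ht, x, hx, rfl⟩
    rw [← hcov] at hx
    simp only [mem_iUnion, mem_image] at hx
    obtain ⟨γ, hγ, k, hk, rfl⟩ := hx
    have himg := hpres γ hγ
    have hmem : ∀ z, γ z ∈ coneOver Ω ↔ z ∈ coneOver Ω := by
      intro z
      constructor
      · intro h
        rw [← himg] at h
        obtain ⟨y, hy, hyz⟩ := h
        rwa [← γ.injective hyz]
      · exact fun h => himg ▸ mem_image_of_mem γ h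
    have hs := (mem_coneOver_iff.1 ((hmem _).2 (mk_one_mem_coneOver_iff.2 (hKΩ hk)))).1
    set s := (γ (k, 1)).2 with hs_def
    have hst : 0 < s / t := div_pos hs ht
    have hγk : s • ((projAct γ k, 1) : Euc d × ℝ) = γ (k, 1) := by
      ext1
      · simp [projAct, smul_smul, ← hs_def, hs.ne']
      · simp [hs_def]
    refine ⟨(s / t) • γ.symm.toLinearMap, fun z => ?_, k, hk, ?_⟩
    · constructor
      · intro hz
        have h1 := smul_mem_coneOver (inv_pos.2 hst) hz
        rw [LinearMap.smul_apply, smul_smul, inv_mul_cancel₀ hst.ne', one_smul] at h1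
        simpa using (hmem _).2 h1
      · exact fun hz => smul_mem_coneOver hst ((hmem _).1 (by simpa using hz))
    · rw [LinearMap.smul_apply, map_smul, smul_smul, div_mul_cancel₀ _ ht.ne', ← map_smul, hγk]
      simp

end ConeOver

theorem boundary_segment_meeting_flat_boundary {d : ℕ} (Ω : Set (Euc d)) (hne : Ω.Nonempty)
    (hbd : Bornology.IsBounded Ω) (hop : IsOpen Ω) (hconv : Convex ℝ Ω)
    (hd : 3 ≤ d) (hirr : IsIrreducibleDomain Ω)
    (Γ : Subgroup ((Euc d × ℝ) ≃ₗ[ℝ] (Euc d × ℝ)))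
    (htf : TorsionFreeSub Γ) (hdiv : Divides Ω Γ)
    (F : Set (Euc d)) (hF : IsFlat Ω F) (a b : Euc d) (hab : a ≠ b)
    (hseg : segment ℝ a b ⊆ closure Ω \ Ω)
    (hmeet : (segment ℝ a b ∩ (closure F \ F)).Nonempty) :
    segment ℝ a b ⊆ closure F \ F := by
  obtain ⟨v, ⟨hv, hvb, hint, hbdry⟩, rfl⟩ := hF
  obtain ⟨p, hpseg, hpF, hpnF⟩ := hmeet
  have hFne : (intrinsicInterior ℝ (convexHull ℝ (range v))).Nonempty :=
    closure_nonempty_iff.1 ⟨p, hpF⟩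
  have hhull : closure (intrinsicInterior ℝ (convexHull ℝ (range v))) ⊆ convexHull ℝ (range v) :=
    closure_minimal intrinsicInterior_subset ((finite_range v).isClosed_convexHull ℝ)
  have hC := isOpenConvexCone_coneOver hne hop hconv
  obtain ⟨ψ, hψ⟩ := exists_norm_le_of_mem_coneOver hbd
  have : Nontrivial (Fin d) := Fin.nontrivial_iff_two_le.2 (by omega)
  have hlift : ∀ c : Fin d → ℝ, ∑ i, c i • ((v i, 1) : Euc d × ℝ) =
      (∑ i, c i • v i, ∑ i, c i) := by
    intro c
    ext1 <;> simp [Prod.fst_sum, Prod.snd_sum]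
  have hu : ∀ i, ((v i, 1) : Euc d × ℝ) ∈ closure (coneOver Ω) := fun i =>
    mk_one_mem_closure_coneOver (hvb i).1
  have hsum : ∑ i, ((v i, 1) : Euc d × ℝ) ∈ coneOver Ω := by
    obtain ⟨o, ho⟩ := hFne
    obtain ⟨c, hc, hc1, hco⟩ := mem_convexHull_range_iff.1 (intrinsicInterior_subset ho)
    have h1 : ∑ i, c i • ((v i, 1) : Euc d × ℝ) ∈ coneOver Ω := by
      rw [hlift, hco, hc1]
      exact mk_one_mem_coneOver_iff.2 (hint ho)
    have hle : ∀ i ∈ Finset.univ, 0 ≤ 1 - c i := fun i hi =>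
      sub_nonneg.2 (hc1 ▸ Finset.single_le_sum (fun j _ => hc j) hi)
    have h2 := hC.add_mem_of_closure h1 (hC.closure_sum_smul_mem _ hle fun i _ => hu i)
    rw [← Finset.sum_add_distrib] at h2
    simpa [← add_smul] using h2
  have hfacet : ∀ j, ∑ i ∈ Finset.univ.erase j, ((v i, 1) : Euc d × ℝ) ∉ coneOver Ω := by
    intro j hj
    rw [mem_coneOver_iff, Prod.fst_sum, Prod.snd_sum] at hj
    obtain ⟨h1, h2⟩ := hj
    set r : ℝ := ∑ i ∈ Finset.univ.erase j, 1 with hr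
    let c : Fin d → ℝ := fun i => if i = j then 0 else r⁻¹
    have hc : ∀ i, 0 ≤ c i := by
      intro i
      simp only [c]
      split_ifs
      exacts [le_rfl, (inv_pos.2 h1).le]
    have hc1 : ∑ i, c i = 1 := by
      rw [← Finset.add_sum_erase _ _ (Finset.mem_univ j),
        Finset.sum_congr rfl fun i hi => if_neg (Finset.ne_of_mem_erase hi)]
      have h3 : ∑ i ∈ Finset.univ.erase j, r⁻¹ = r * r⁻¹ := by
        rw [hr, Finset.sum_mul]
        simp only [one_mul]
      rw [h3, mul_inv_cancel₀ h1.ne', show c j = 0 from if_pos rfl, zero_add]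
    have hcs : ∑ i, c i • v i = r⁻¹ • ∑ i ∈ Finset.univ.erase j, v i := by
      rw [← Finset.add_sum_erase _ _ (Finset.mem_univ j), Finset.smul_sum,
        Finset.sum_congr rfl fun i hi => by
          rw [show c i = r⁻¹ from if_neg (Finset.ne_of_mem_erase hi)]]
      simp [c]
    rw [← hcs] at h2
    exact (hbdry ⟨mem_convexHull_range_iff.2 ⟨c, hc, hc1, rfl⟩,
      hv.sum_notMem_intrinsicInterior hc1 (if_pos rfl)⟩).2 h2
  obtain ⟨c, hc, hc1, hcp⟩ := mem_convexHull_range_iff.1 (hhull hpF)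
  have hc0 : ∃ i, 0 < c i := by
    by_contra! h
    have := Finset.sum_nonpos fun i (_ : i ∈ Finset.univ) => h i
    linarith
  intro z hz
  have hmid : ∑ i, c i • ((v i, 1) : Euc d × ℝ) + (z, 1) ∉ coneOver Ω := by
    rw [hlift, hcp, hc1, mem_coneOver_iff]
    rintro ⟨-, h⟩
    refine (hseg (convex_segment a b hpseg hz (a := 1 / 2) (b := 1 / 2) (by norm_num)
      (by norm_num) (by norm_num))).2 ?_
    rw [← smul_add]
    norm_num at h ⊢
    exact h
  obtain ⟨x, hx, hzx⟩ := hdiv.isQuasiHomogeneous_coneOver.exists_eq_sum_of_add_notMem hC hψ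
    hirr (by simp) hu hsum hfacet hc hc0 (mk_one_mem_closure_coneOver (hseg hz).1) hmid
  rw [hlift, Prod.mk.injEq] at hzx
  exact ⟨(convex_convexHull ℝ _).subset_closure_intrinsicInterior hFne
    (mem_convexHull_range_iff.2 ⟨x, hx, hzx.2.symm, hzx.1.symm⟩), fun h => (hseg hz).2 (hint h)⟩
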